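/- Let λ_0, …, λ_5 be pairwise distinct complex numbers. Then Σ_{0≤i<j≤5} (λ_i + λ_j)^4 · P_3(λ_i,λ_j)^2 / D_{ij} = 6. -/

import Mathlib

open Finset in
/-- Bott denominator: `D_{ij} = ∏_{k ≠ i,j} (λ_i − λ_k)(λ_j − λ_k)`. -/
noncomputable def bottD {n : ℕ} (l : Fin n → ℂ) (i j : Fin n) : ℂ :=
  ∏ k ∈ (Finset.univ \ {i, j}), (l i - l k) * (l j - l k)

/-- `P_c(x,y) = Σ_{t=0}^{c−1} x^t y^{c−1−t}`. -/
noncomputable def bottP (c : ℕ) (x y : ℂ) : ℂ :=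
  ∑ t ∈ Finset.range c, x ^ t * y ^ (c - 1 - t)

/-- A symmetric function vanishing on the diagonal sums over all ordered pairs to twice its sum
over the strictly increasing pairs. -/
theorem sum_sum_eq_two_mul_sum_filter_lt {ι R : Type*} [Fintype ι] [LinearOrder ι] [CommRing R]
    (g : ι → ι → R) (hsymm : ∀ i j, g i j = g j i) (hdiag : ∀ i, g i i = 0) :
    ∑ i, ∑ j, g i j =
      2 * ∑ p ∈ Finset.univ.filter (fun p : ι × ι => p.1 < p.2), g p.1 p.2 := by
  have hswap : ∑ p ∈ Finset.univ.filter (fun p : ι × ι => ¬ p.1 < p.2), g p.1 p.2 =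
      ∑ p ∈ Finset.univ.filter (fun p : ι × ι => p.1 < p.2), g p.1 p.2 := by
    symm
    refine Finset.sum_of_injOn Prod.swap Prod.swap_injective.injOn ?_ ?_ ?_
    · intro p hp
      simpa using (show p.1 < p.2 by simpa using hp).le
    · intro p hp hp'
      have hle : p.2 ≤ p.1 := by simpa using hp
      rcases hle.eq_or_lt with h | h
      · rw [h, hdiag]
      · exact absurd ⟨p.swap, by simpa using h, by simp⟩ hp'
    · intro p _
      exact hsymm _ _
  rw [← Fintype.sum_prod_type', ← Finset.sum_filter_add_sum_filter_not Finset.univ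
    (fun p : ι × ι => p.1 < p.2), hswap, two_mul]

/-- The weighted power sums `∑ i, x_i ^ a / ∏_{k ≠ i} (x_i - x_k)` over `n` distinct nodes, for
`a < n`. -/
theorem sum_pow_div_prod_sub {F : Type*} [Field F] {n : ℕ} (l : Fin n → F)
    (hl : Function.Injective l) {a : ℕ} (ha : a < n) :
    ∑ i, l i ^ a / ∏ k ∈ Finset.univ.erase i, (l i - l k) = if a + 1 = n then 1 else 0 := by
  have h := Lagrange.coeff_eq_sum (s := Finset.univ) (v := l) hl.injOn
    (P := (Polynomial.X : Polynomial F) ^ a) (by simpa using ha)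
  simp only [Polynomial.eval_pow, Polynomial.eval_X, Polynomial.coeff_X_pow, Finset.card_univ,
    Fintype.card_fin] at h
  rw [← h]
  exact if_congr (by omega) rfl rfl

/-- The Bott denominator in terms of the full products `∏_{k ≠ i} (l i - l k)`. -/
theorem neg_sub_sq_mul_bottD {n : ℕ} (l : Fin n → ℂ) {i j : Fin n} (hij : i ≠ j) :
    -(l i - l j) ^ 2 * bottD l i j =
      (∏ k ∈ Finset.univ.erase i, (l i - l k)) * ∏ k ∈ Finset.univ.erase j, (l j - l k) := by
  have hi : (Finset.univ.erase i).erase j = Finset.univ \ {i, j} := by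
    ext k; simp [and_comm]
  have hj : (Finset.univ.erase j).erase i = Finset.univ \ {i, j} := by
    ext k; simp
  rw [← Finset.mul_prod_erase (Finset.univ.erase i) _ (by simpa using hij.symm),
    ← Finset.mul_prod_erase (Finset.univ.erase j) _ (by simpa using hij), hi, hj, bottD,
    Finset.prod_mul_distrib]
  ring

/-- Bott's formula for `N_1(3,2,0,0) = 6` in ℙ⁵. -/
theorem bott_sum_12 (l : Fin 6 → ℂ) (hl : Function.Injective l) :
    ∑ p ∈ Finset.univ.filter (fun p : Fin 6 × Fin 6 => p.1 < p.2),
      (l p.1 + l p.2) ^ 4 * (bottP 3 (l p.1) (l p.2)) ^ 2 / bottD l p.1 p.2 = 6 := by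
  set d : Fin 6 → ℂ := fun i => ∏ k ∈ Finset.univ.erase i, (l i - l k) with hd
  let g : Fin 6 → Fin 6 → ℂ := fun i j =>
    -(l i ^ 3 - l j ^ 3) ^ 2 * (l i + l j) ^ 4 / (d i * d j)
  have hterm : ∀ p ∈ Finset.univ.filter (fun p : Fin 6 × Fin 6 => p.1 < p.2),
      (l p.1 + l p.2) ^ 4 * (bottP 3 (l p.1) (l p.2)) ^ 2 / bottD l p.1 p.2 = g p.1 p.2 := by
    intro p hp
    have hne : p.1 ≠ p.2 := (Finset.mem_filter.mp hp).2.ne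
    have hsub : -(l p.1 - l p.2) ^ 2 ≠ 0 :=
      neg_ne_zero.mpr (pow_ne_zero 2 (sub_ne_zero.mpr (hl.ne hne)))
    simp only [g, hd]
    rw [← neg_sub_sq_mul_bottD l hne, ← mul_div_mul_left _ _ hsub]
    congr 1
    simp only [bottP, Finset.sum_range_succ, Finset.sum_range_zero]
    ring
  have hdouble := sum_sum_eq_two_mul_sum_filter_lt g
    (fun i j => by simp only [g]; rw [mul_comm (d i)]; congr 1; ring)
    (fun i => by simp [g])
  let S : ℕ → ℂ := fun a => ∑ i, l i ^ a / d i
  have hS : ∀ a, a < 6 → S a = if a + 1 = 6 then 1 else 0 :=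
    fun a ha => sum_pow_div_prod_sub l hl ha
  have hprod : ∀ a b, ∑ i, ∑ j, (l i ^ a / d i) * (l j ^ b / d j) = S a * S b :=
    fun a b => (Finset.sum_mul_sum _ _ _ _).symm
  have hexpand : ∑ i, ∑ j, g i j =
      -(S 10 * S 0) - 4 * (S 9 * S 1) - 6 * (S 8 * S 2) - 2 * (S 7 * S 3) + 7 * (S 6 * S 4)
        + 12 * (S 5 * S 5) + 7 * (S 4 * S 6) - 2 * (S 3 * S 7) - 6 * (S 2 * S 8)
        - 4 * (S 1 * S 9) - S 0 * S 10 := by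
    simp only [← hprod, Finset.mul_sum, ← Finset.sum_add_distrib, ← Finset.sum_sub_distrib,
      ← Finset.sum_neg_distrib]
    refine Finset.sum_congr rfl fun i _ => Finset.sum_congr rfl fun j _ => ?_
    simp only [g]
    ring
  rw [Finset.sum_congr rfl hterm]
  have h0 := hS 0 (by norm_num)
  have h1 := hS 1 (by norm_num)
  have h2 := hS 2 (by norm_num)
  have h3 := hS 3 (by norm_num)
  have h4 := hS 4 (by norm_num)
  have h5 := hS 5 (by norm_num)
  norm_num at h0 h1 h2 h3 h4 h5
  rw [hexpand, h0, h1, h2, h3, h4, h5] at hdouble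
  linear_combination -hdouble / 2
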